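/- Let n ≥ 1 be an integer and F(θ) = √(∑_{k=0}^{n−1} (cos θ)^{2k}). Consider the vector field X on ℝ³ given by X(θ,T,Q) = ( −T·F(θ) + 3Q(T−1)·F(θ)²·sin(2θ)/(2n), 3Q(T−1)²·T·(1−(cos θ)^{2n})/n, (Q²−1)(T−1)(3(cos θ)^{2n} − 1) ). Then the point (θ,T,Q) = (0,0,1) is an equilibrium of X and it is unstable (it is not Lyapunov stable). -/

import Mathlib

open Real Filter

noncomputable section

/-- Lyapunov stability of the equilibrium `p` of the vector field `X` on the domain `D`. -/
def LyapunovStable {E : Type*} [NormedAddCommGroup E] [NormedSpace ℝ E]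
    (X : E → E) (D : Set E) (p : E) : Prop :=
  ∀ ε > 0, ∃ δ > 0, ∀ γ : ℝ → E,
    (∀ t : ℝ, 0 ≤ t → γ t ∈ D) →
    (∀ t : ℝ, 0 ≤ t → HasDerivAt γ (X (γ t)) t) →
    ‖γ 0 - p‖ < δ → ∀ t : ℝ, 0 ≤ t → ‖γ t - p‖ < ε

/-- `F θ = √(∑_{k=0}^{n-1} (cos θ)^{2k})`. -/
def F (n : ℕ) (θ : ℝ) : ℝ :=
  Real.sqrt (∑ k ∈ Finset.range n, Real.cos θ ^ (2 * k))

/-- The unwrapped vector field (non-flat, Λ = 0, detailed balance, power-law potential);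
coordinates `(θ, T, Q)`. -/
def X5 (n : ℕ) (p : ℝ × ℝ × ℝ) : ℝ × ℝ × ℝ :=
  (-p.2.1 * F n p.1 + 3 * p.2.2 * (p.2.1 - 1) * F n p.1 ^ 2 * Real.sin (2 * p.1) / (2 * n),
   3 * p.2.2 * (p.2.1 - 1) ^ 2 * p.2.1 * (1 - Real.cos p.1 ^ (2 * n)) / n,
   (p.2.2 ^ 2 - 1) * (p.2.1 - 1) * (3 * Real.cos p.1 ^ (2 * n) - 1))

/-- A bounded `C¹` vector field on a finite-dimensional space has global integral curves. -/
theorem exists_forall_hasDerivAt_of_contDiff_of_bounded {E : Type*} [NormedAddCommGroup E]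
    [NormedSpace ℝ E] [FiniteDimensional ℝ E] {v : E → E} (hv : ContDiff ℝ 1 v) {C : ℝ}
    (hC : ∀ x, ‖v x‖ ≤ C) (x₀ : E) :
    ∃ γ : ℝ → E, γ 0 = x₀ ∧ ∀ t, HasDerivAt γ (v (γ t)) t := by
  have : CompleteSpace E := FiniteDimensional.complete ℝ E
  have : ProperSpace E := FiniteDimensional.proper ℝ E
  have hC0 : 0 ≤ C := (norm_nonneg _).trans (hC 0)
  lift C to NNReal using hC0
  have hvM : ContMDiff (modelWithCornersSelf ℝ E) (modelWithCornersSelf ℝ E).tangent 1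
      (fun x ↦ (⟨x, v x⟩ : TangentBundle (modelWithCornersSelf ℝ E) E)) :=
    contMDiff_vectorSpace_iff_contDiff.2 hv
  obtain ⟨γ, h0, hγ⟩ := exists_isMIntegralCurve_of_isMIntegralCurveOn (M := E) (v := v) hvM
    one_pos (fun x ↦ by
      obtain ⟨K, hK⟩ := (hv.contDiffOn (s := Metric.closedBall x C)).exists_lipschitzOnWith
        one_ne_zero (convex_closedBall x _) (isCompact_closedBall x _)
      have hpl : IsPicardLindelof (fun _ ↦ v) (tmin := -1) (tmax := 1)
          ⟨0, by simp⟩ x C 0 C K :=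
        { lipschitzOnWith := fun _ _ ↦ hK
          continuousOn := fun _ _ ↦ continuousOn_const
          norm_le := fun _ _ y _ ↦ hC y
          mul_max_le := by simp }
      obtain ⟨α, hα0, hα⟩ := hpl.exists_eq_forall_mem_Icc_hasDerivWithinAt₀
      exact ⟨α, hα0, fun t ht ↦
        ((hα t (Set.Ioo_subset_Icc_self ht)).mono
          Set.Ioo_subset_Icc_self).hasFDerivWithinAt.hasMFDerivWithinAt⟩) x₀
  exact ⟨γ, h0, fun t ↦ by
    have h : HasFDerivAt γ ((1 : ℝ →L[ℝ] ℝ).smulRight (v (γ t))) t := (hγ t).hasFDerivAt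
    simpa using h.hasDerivAt⟩

theorem F_sq (n : ℕ) (θ : ℝ) : F n θ ^ 2 = ∑ k ∈ Finset.range n, cos θ ^ (2 * k) :=
  sq_sqrt (Finset.sum_nonneg fun k _ ↦ by rw [pow_mul]; positivity)

theorem F_sq_le (n : ℕ) (θ : ℝ) : F n θ ^ 2 ≤ n := by
  rw [F_sq]
  calc ∑ k ∈ Finset.range n, cos θ ^ (2 * k) ≤ ∑ k ∈ Finset.range n, (1 : ℝ) :=
        Finset.sum_le_sum fun k _ ↦ by
          rw [pow_mul]; exact pow_le_one₀ (sq_nonneg _) (cos_sq_le_one θ)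
    _ = n := by simp

theorem one_le_sum_cos_pow {n : ℕ} (hn : 1 ≤ n) (θ : ℝ) :
    1 ≤ ∑ k ∈ Finset.range n, cos θ ^ (2 * k) := by
  have h := Finset.single_le_sum (f := fun k ↦ cos θ ^ (2 * k)) (s := Finset.range n)
    (fun k _ ↦ by rw [pow_mul]; positivity) (Finset.mem_range.2 hn)
  simpa using h

theorem one_le_F {n : ℕ} (hn : 1 ≤ n) (θ : ℝ) : 1 ≤ F n θ :=
  one_le_sqrt.2 (one_le_sum_cos_pow hn θ)

theorem contDiff_F {n : ℕ} (hn : 1 ≤ n) : ContDiff ℝ 1 (F n) := by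
  have h : ContDiff ℝ 1 fun θ ↦ ∑ k ∈ Finset.range n, cos θ ^ (2 * k) := by fun_prop
  exact h.sqrt fun θ ↦ (one_pos.trans_le (one_le_sum_cos_pow hn θ)).ne'

theorem cos_pow_two_mul_nonneg (n : ℕ) (θ : ℝ) : 0 ≤ cos θ ^ (2 * n) := by
  rw [pow_mul]; positivity

theorem sin_sq_le_one_sub_cos_pow {n : ℕ} (hn : 1 ≤ n) (θ : ℝ) :
    sin θ ^ 2 ≤ 1 - cos θ ^ (2 * n) := by
  have h : (cos θ ^ 2) ^ n ≤ (cos θ ^ 2) ^ 1 :=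
    pow_le_pow_of_le_one (sq_nonneg _) (cos_sq_le_one θ) hn
  rw [pow_mul]
  linarith [sin_sq_add_cos_sq θ]

/-- The restriction of `X5 n` to the invariant strip `Q = 1`, `0 ≤ T ≤ 1`, in the coordinates
`(θ, φ)` with `T = sin² φ`. -/
def stripField (n : ℕ) (p : ℝ × ℝ) : ℝ × ℝ :=
  (-sin p.2 ^ 2 * F n p.1 - 3 * cos p.2 ^ 2 * F n p.1 ^ 2 * sin (2 * p.1) / (2 * n),
   3 * cos p.2 ^ 3 * sin p.2 * (1 - cos p.1 ^ (2 * n)) / (2 * n))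

theorem contDiff_stripField {n : ℕ} (hn : 1 ≤ n) : ContDiff ℝ 1 (stripField n) := by
  have := contDiff_F hn
  unfold stripField
  fun_prop

theorem norm_stripField_le {n : ℕ} (hn : 1 ≤ n) (p : ℝ × ℝ) : ‖stripField n p‖ ≤ n + 2 := by
  have hn' : (1 : ℝ) ≤ n := by exact_mod_cast hn
  have hF1 := one_le_F hn p.1
  have hF2 := F_sq_le n p.1
  have hs := abs_sin_le_one p.2
  have hc := abs_cos_le_one p.2
  have hw : |1 - cos p.1 ^ (2 * n)| ≤ 1 := by
    rw [abs_le]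
    constructor <;>
      linarith [cos_pow_two_mul_nonneg n p.1, sin_sq_le_one_sub_cos_pow hn p.1,
        sq_nonneg (sin p.1)]
  have h1 : |sin p.2 ^ 2 * F n p.1| ≤ n := by
    rw [abs_mul, abs_pow, abs_of_nonneg (zero_le_one.trans hF1)]
    calc |sin p.2| ^ 2 * F n p.1 ≤ 1 * F n p.1 := by
          gcongr; exact pow_le_one₀ (abs_nonneg _) hs
      _ ≤ n := by nlinarith
  have h2 : |3 * cos p.2 ^ 2 * F n p.1 ^ 2 * sin (2 * p.1) / (2 * n)| ≤ 2 := by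
    rw [abs_div, abs_of_pos (by positivity : (0 : ℝ) < 2 * n), div_le_iff₀ (by positivity)]
    simp only [abs_mul, abs_pow, abs_of_nonneg (zero_le_one.trans hF1)]
    calc |(3 : ℝ)| * |cos p.2| ^ 2 * F n p.1 ^ 2 * |sin (2 * p.1)| ≤ 3 * 1 * n * 1 := by
          gcongr
          · norm_num
          · exact pow_le_one₀ (abs_nonneg _) hc
          · exact abs_sin_le_one _
      _ ≤ 2 * (2 * n) := by linarith
  have h3 : |3 * cos p.2 ^ 3 * sin p.2 * (1 - cos p.1 ^ (2 * n)) / (2 * n)| ≤ 2 := by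
    rw [abs_div, abs_of_pos (by positivity : (0 : ℝ) < 2 * n), div_le_iff₀ (by positivity)]
    rw [abs_mul, abs_mul, abs_mul, abs_pow]
    calc |(3 : ℝ)| * |cos p.2| ^ 3 * |sin p.2| * |1 - cos p.1 ^ (2 * n)| ≤ 3 * 1 * 1 * 1 := by
          gcongr
          · norm_num
          · exact pow_le_one₀ (abs_nonneg _) hc
      _ ≤ 2 * (2 * n) := by linarith
  refine max_le ?_ ?_
  · simp only [stripField, norm_eq_abs, neg_mul]
    refine (abs_sub _ _).trans ?_
    rw [abs_neg]
    linarith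
  · simp only [stripField, norm_eq_abs]
    linarith

/-- Through every point of the strip `Q = 1`, `0 ≤ T ≤ 1` there is a global integral curve of
`X5 n` that stays in the strip. -/
theorem exists_integralCurve_strip {n : ℕ} (hn : 1 ≤ n) (θ₀ φ₀ : ℝ) :
    ∃ θ T : ℝ → ℝ, θ 0 = θ₀ ∧ T 0 = sin φ₀ ^ 2 ∧ (∀ t, 0 ≤ T t) ∧ (∀ t, T t ≤ 1) ∧
      ∀ t, HasDerivAt (fun t ↦ (θ t, T t, (1 : ℝ))) (X5 n (θ t, T t, 1)) t := by
  obtain ⟨γ, h0, hγ⟩ := exists_forall_hasDerivAt_of_contDiff_of_bounded (contDiff_stripField hn)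
    (norm_stripField_le hn) (θ₀, φ₀)
  refine ⟨fun t ↦ (γ t).1, fun t ↦ sin (γ t).2 ^ 2, by simp [h0], by simp [h0],
    fun t ↦ sq_nonneg _, fun t ↦ sin_sq_le_one _, fun t ↦ ?_⟩
  have h1 : HasDerivAt (fun t ↦ (γ t).1) (stripField n (γ t)).1 t := (hγ t).fst
  have h2 : HasDerivAt (fun t ↦ (γ t).2) (stripField n (γ t)).2 t := (hγ t).snd
  have h3 := h2.sin.pow 2
  have hc : sin (γ t).2 ^ 2 - 1 = -cos (γ t).2 ^ 2 := by
    linarith [sin_sq_add_cos_sq (γ t).2]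
  have hn' : (n : ℝ) ≠ 0 := by exact_mod_cast (by omega : n ≠ 0)
  refine (h1.prodMk (h3.prodMk (hasDerivAt_const t (1 : ℝ)))).congr_deriv ?_
  simp only [X5, stripField, hc, Prod.mk.injEq]
  refine ⟨by ring, ?_, by ring⟩
  field_simp
  push_cast
  ring

theorem stmt_5 (n : ℕ) (hn : 1 ≤ n) :
    X5 n (0, 0, 1) = (0, 0, 0) ∧
      ¬ LyapunovStable (X5 n) (Set.univ : Set (ℝ × ℝ × ℝ)) (0, 0, 1) := by
  refine ⟨by simp [X5], fun hst ↦ ?_⟩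
  have hn' : (1 : ℝ) ≤ n := by exact_mod_cast hn
  obtain ⟨δ, hδ, hst⟩ := hst (1 / 2) (by norm_num)
  obtain ⟨φ₀, hφ0, hφ1, hφδ⟩ : ∃ φ₀ : ℝ, 0 < φ₀ ∧ φ₀ ≤ 1 ∧ φ₀ < δ :=
    ⟨min 1 (δ / 2), by positivity, min_le_left _ _, (min_le_right _ _).trans_lt (by linarith)⟩
  obtain ⟨T₀, hT₀⟩ : ∃ T₀, T₀ = sin φ₀ ^ 2 := ⟨_, rfl⟩
  have hsin0 : 0 < sin φ₀ := sin_pos_of_pos_of_le_one hφ0 hφ1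
  have hT₀pos : 0 < T₀ := hT₀ ▸ pow_pos hsin0 2
  have hT₀δ : T₀ < δ := by nlinarith [sin_lt hφ0, sin_le_one φ₀]
  obtain ⟨θ, T, hθ0, hT0, hTnn, hT1, hder⟩ := exists_integralCurve_strip hn (-(T₀ / 6)) φ₀
  rw [← hT₀] at hT0
  have hsmall := hst (fun t ↦ (θ t, T t, 1)) (fun _ _ ↦ trivial) (fun t _ ↦ hder t) (by
    simp only [hθ0, hT0, Prod.mk_sub_mk, sub_zero, sub_self, Prod.norm_mk, norm_neg, norm_zero,
      norm_eq_abs, abs_of_pos hT₀pos, abs_of_pos (by positivity : 0 < T₀ / 6)]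
    exact max_lt (by linarith) (max_lt hT₀δ hδ))
  have hθT : ∀ t, 0 ≤ t → |θ t| < 1 / 2 ∧ T t < 1 / 2 := fun t ht ↦ by
    have h := hsmall t ht
    simp only [Prod.mk_sub_mk, sub_zero, sub_self, Prod.norm_mk, norm_zero, norm_eq_abs,
      max_lt_iff] at h
    exact ⟨h.1, (le_abs_self _).trans_lt h.2.1⟩
  have hθd : ∀ t, HasDerivAt θ (X5 n (θ t, T t, 1)).1 t := fun t ↦ (hder t).fst
  have hTd : ∀ t, HasDerivAt T (X5 n (θ t, T t, 1)).2.1 t := fun t ↦ (hder t).snd.fst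
  have hTd0 : ∀ t, sin (θ t) ^ 2 * (3 * (T t - 1) ^ 2 * T t / n) ≤
      (X5 n (θ t, T t, 1)).2.1 := fun t ↦ by
    have := mul_le_mul_of_nonneg_right (sin_sq_le_one_sub_cos_pow hn (θ t))
      (by have := hTnn t; positivity : 0 ≤ 3 * (T t - 1) ^ 2 * T t / n)
    refine this.trans_eq ?_
    simp only [X5]
    ring
  have hmono : Monotone T := monotone_of_hasDerivAt_nonneg hTd fun t ↦
    (by have := hTnn t; positivity : (0 : ℝ) ≤ _).trans (hTd0 t)
  have hTge : ∀ t, 0 ≤ t → T₀ ≤ T t := fun t ht ↦ hT0 ▸ hmono ht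
  have hθle : ∀ t, 0 ≤ t → θ t ≤ -(T₀ / 6) := fun t ht ↦ by
    refine image_le_of_deriv_right_lt_deriv_boundary (a := 0) (b := t)
      (fun s _ ↦ (hθd s).continuousAt.continuousWithinAt) (fun s _ ↦ (hθd s).hasDerivWithinAt)
      hθ0.le (fun s ↦ hasDerivAt_const s _) (fun s hs hθs ↦ ?_) ⟨ht, le_rfl⟩
    have hF1 := one_le_F hn (θ s)
    have hF2 := F_sq_le n (θ s)
    have hsin : 0 ≤ sin (2 * (T₀ / 6)) ∧ sin (2 * (T₀ / 6)) ≤ 2 * (T₀ / 6) :=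
      ⟨sin_nonneg_of_nonneg_of_le_pi (by positivity)
        (by linarith [pi_gt_three, hT1 0]), sin_le (by positivity)⟩
    have h1 : T₀ ≤ T s * F n (θ s) := by nlinarith [hTge s hs.1]
    have h2 : 3 * (1 - T s) * F n (θ s) ^ 2 * sin (2 * (T₀ / 6)) / (2 * n) ≤ T₀ / 2 := by
      rw [div_le_iff₀ (by positivity)]
      calc 3 * (1 - T s) * F n (θ s) ^ 2 * sin (2 * (T₀ / 6))
          ≤ 3 * 1 * n * (2 * (T₀ / 6)) := by
            have := hT1 s
            gcongr
            · exact hsin.1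
            · linarith [hTnn s]
            · exact hsin.2
        _ = T₀ / 2 * (2 * n) := by ring
    have h3 : (X5 n (θ s, T s, 1)).1 = -(T s * F n (θ s)) +
        3 * (1 - T s) * F n (θ s) ^ 2 * sin (2 * (T₀ / 6)) / (2 * n) := by
      have h4 : sin (2 * θ s) = -sin (2 * (T₀ / 6)) := by rw [hθs, ← sin_neg]; ring_nf
      simp only [X5, h4]
      ring
    rw [h3]
    linarith
  have hs0 : 0 < sin (T₀ / 6) :=
    sin_pos_of_pos_of_le_one (by positivity) (by linarith [hT1 0])
  obtain ⟨c, hc⟩ : ∃ c, c = sin (T₀ / 6) ^ 2 * (3 * (1 / 2) ^ 2 * T₀ / n) := ⟨_, rfl⟩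
  have hcpos : 0 < c := by rw [hc]; positivity
  have hTc : ∀ t, 0 ≤ t → c ≤ (X5 n (θ t, T t, 1)).2.1 := fun t ht ↦ by
    refine le_trans ?_ (hTd0 t)
    obtain ⟨ha, hb⟩ := hθT t ht
    have hs : sin (T₀ / 6) ≤ sin (-θ t) :=
      sin_le_sin_of_le_of_le_pi_div_two (by linarith [pi_gt_three])
        (by linarith [pi_gt_three, neg_abs_le (θ t)]) (by linarith [hθle t ht])
    have h1 : sin (T₀ / 6) ^ 2 ≤ sin (θ t) ^ 2 := by
      rw [← neg_sq (sin (θ t)), ← sin_neg]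
      gcongr
    have h2 : (1 / 2 : ℝ) ^ 2 ≤ (T t - 1) ^ 2 := by nlinarith
    have h3 := hTge t ht
    rw [hc]
    gcongr
  have hgrow : c * (1 / c - 0) ≤ T (1 / c) - T 0 :=
    (convex_Ici (0 : ℝ)).mul_sub_le_image_sub_of_le_deriv
      (fun t _ ↦ (hTd t).continuousAt.continuousWithinAt)
      (fun t _ ↦ (hTd t).differentiableAt.differentiableWithinAt)
      (fun t ht ↦ by rw [(hTd t).deriv]; exact hTc t (interior_subset ht))
      0 Set.self_mem_Ici _ (by positivity : (0 : ℝ) ≤ 1 / c) (by positivity)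
  rw [sub_zero, mul_one_div_cancel hcpos.ne'] at hgrow
  linarith [hT1 (1 / c)]
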